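/- Let X be a one-sided subshift of finite type with Gibbs measure μ for a Hölder potential φ with pressure P, let f : X → (1,∞) be d_θ-Lipschitz, let {I_n} satisfy the nested condition with ∩_n I_n = {z}, and let δ > 0, m ∈ ℕ and ḡ = f̄_{m,δ}, g̲ = f̲_{m,δ} be the upper and lower δℤ-valued approximations of f on cylinders of length m, assumed to satisfy 0 < g̲ ≤ f ≤ ḡ, ∫g̲ dμ ≥ (1/2)∫f dμ and ∫ḡ dμ ≤ 2∫f dμ. Assume the discrete escape rate limits hold for the two discretised systems: lim_{n→∞} R_D(μ̃^{ḡ}, I_n×{0}) / μ̃^{ḡ}(I_n×{0}) = γ(z) and lim_{n→∞} R_D(μ̃^{g̲}, I_n×{0}) / μ̃^{g̲}(I_n×{0}) = γ(z). Then γ(z)/∫ḡ dμ ≤ liminf_{n→∞} R(μ^f, I_n×{0}, Λ_f)/μ(I_n) and limsup_{n→∞} R(μ^f, I_n×{0}, Λ_f)/μ(I_n) ≤ γ(z)/∫g̲ dμ. -/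

import Mathlib

open Filter Set MeasureTheory

noncomputable section

/-- The one-sided full shift map on sequences over the alphabet `Fin a`. -/
def shiftMap (a : ℕ) : (ℕ → Fin a) → (ℕ → Fin a) := fun x n => x (n + 1)

/-- The one-sided subshift of finite type determined by the 0-1 transition matrix `A`. -/
def SFT {a : ℕ} (A : Matrix (Fin a) (Fin a) ℕ) : Set (ℕ → Fin a) :=
  {x | ∀ n, A (x n) (x (n + 1)) = 1}

/-- The cylinder of length `n` around `x`. -/
def cyl {a : ℕ} (x : ℕ → Fin a) (n : ℕ) : Set (ℕ → Fin a) := {y | ∀ i < n, y i = x i}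

/-- The Birkhoff sum `S_m f(x) = Σ_{k<m} f(σ^k x)`. -/
def birkhoff {a : ℕ} (f : (ℕ → Fin a) → ℝ) (m : ℕ) (x : ℕ → Fin a) : ℝ :=
  ∑ k ∈ Finset.range m, f ((shiftMap a)^[k] x)

/-- The suspension space `Λ_f = {(x,t) : x ∈ X, 0 ≤ t < f(x)}`. -/
def susp {a : ℕ} (X : Set (ℕ → Fin a)) (f : (ℕ → Fin a) → ℝ) : Set ((ℕ → Fin a) × ℝ) :=
  {p | p.1 ∈ X ∧ 0 ≤ p.2 ∧ p.2 < f p.1}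

open Classical in
/-- The special semi-flow `Φ_f^t` over the shift with roof function `f`:
`Φ_f^t(x,s) = (σ^m x, s + t − S_m f(x))` where `S_m f(x) ≤ s+t < S_{m+1} f(x)`. -/
def susFlow {a : ℕ} (f : (ℕ → Fin a) → ℝ) (t : ℝ) (p : (ℕ → Fin a) × ℝ) :
    (ℕ → Fin a) × ℝ :=
  if h : ∃ m : ℕ, birkhoff f m p.1 ≤ p.2 + t ∧ p.2 + t < birkhoff f (m + 1) p.1 then
    ((shiftMap a)^[h.choose] p.1, p.2 + t - birkhoff f h.choose p.1)
  else p

/-- The normalized suspension measure `μ^f = (μ × Leb)/∫ f dμ` on `Λ_f`. -/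
def suspMeasure {a : ℕ} (μ : Measure (ℕ → Fin a)) [SFinite μ] (X : Set (ℕ → Fin a))
    (f : (ℕ → Fin a) → ℝ) : Measure ((ℕ → Fin a) × ℝ) :=
  (ENNReal.ofReal (∫ x, f x ∂μ))⁻¹ • ((μ.prod volume).restrict (susp X f))


/-- The Birkhoff sum `S_m φ(x)` was defined above; here is the real-valued non-escape
quantity `K(ν,t,H,Λ_f) = log ν{p ∈ Λ_f : Φ_f^s p ∉ H for all s ∈ [0,t]}`. -/
def Kc {a : ℕ} (ν : Measure ((ℕ → Fin a) × ℝ)) (t : ℝ) (H : Set ((ℕ → Fin a) × ℝ))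
    (X : Set (ℕ → Fin a)) (f : (ℕ → Fin a) → ℝ) : ℝ :=
  Real.log (ν {p | p ∈ susp X f ∧ ∀ s ∈ Set.Icc (0 : ℝ) t, susFlow f s p ∉ H}).toReal

/-- The escape rate `R(ν,H,Λ_f) = −limsup_{t→∞} (1/t) K(ν,t,H,Λ_f)`. -/
def Rc {a : ℕ} (ν : Measure ((ℕ → Fin a) × ℝ)) (H : Set ((ℕ → Fin a) × ℝ))
    (X : Set (ℕ → Fin a)) (f : (ℕ → Fin a) → ℝ) : ℝ :=
  - Filter.limsup (fun t : ℝ => Kc ν t H X f / t) Filter.atTop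

/-- The nested condition of Ferguson–Pollicott for a family of sets `I n ⊆ X` shrinking
to a point `z`. -/
def NestedCondition {a : ℕ} (A : Matrix (Fin a) (Fin a) ℕ) (μ : Measure (ℕ → Fin a))
    (I : ℕ → Set (ℕ → Fin a)) (z : ℕ → Fin a) : Prop :=
  (∀ n, 1 ≤ n → ∃ S : Finset (ℕ → Fin a), (↑S : Set (ℕ → Fin a)) ⊆ SFT A ∧
      I n = ⋃ x ∈ S, SFT A ∩ cyl x n) ∧
  (∀ n, 1 ≤ n → I (n + 1) ⊆ I n) ∧
  (⋂ n ∈ Set.Ici 1, I n) = {z} ∧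
  (∃ c : ℝ, 0 < c ∧ ∃ ρ : ℝ, 0 < ρ ∧ ρ < 1 ∧ ∀ n, 1 ≤ n →
      μ (I n) ≤ ENNReal.ofReal (c * ρ ^ n)) ∧
  (∃ l : ℕ → ℕ, ∃ κ : ℝ, 0 < κ ∧ ∀ n : ℕ, 1 ≤ n →
      κ * (n : ℝ) < (l n : ℝ) ∧ l n ≤ n ∧ I n ⊆ SFT A ∩ cyl z (l n)) ∧
  (∀ p : ℕ, 0 < p → (shiftMap a)^[p] z = z →
      (∀ q : ℕ, 0 < q → (shiftMap a)^[q] z = z → p ≤ q) →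
      ∃ N : ℕ, ∀ n, N ≤ n → (shiftMap a)^[p] ⁻¹' (I n) ∩ (SFT A ∩ cyl z p) ⊆ I n)


/-- `sup_{y ∈ [x]_m ∩ X} f(y)`. -/
def cylSup {a : ℕ} (A : Matrix (Fin a) (Fin a) ℕ) (f : (ℕ → Fin a) → ℝ) (m : ℕ)
    (x : ℕ → Fin a) : ℝ :=
  sSup {c : ℝ | ∃ y ∈ SFT A ∩ cyl x m, c = f y}

/-- `inf_{y ∈ [x]_m ∩ X} f(y)`. -/
def cylInf {a : ℕ} (A : Matrix (Fin a) (Fin a) ℕ) (f : (ℕ → Fin a) → ℝ) (m : ℕ)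
    (x : ℕ → Fin a) : ℝ :=
  sInf {c : ℝ | ∃ y ∈ SFT A ∩ cyl x m, c = f y}

/-- The upper approximation `f̄_{m,δ}(x) = (⌊sup_{y∈[x]_m} f(y)/δ⌋ + 2)δ`. -/
def fUpper {a : ℕ} (A : Matrix (Fin a) (Fin a) ℕ) (f : (ℕ → Fin a) → ℝ) (m : ℕ) (δ : ℝ)
    (x : ℕ → Fin a) : ℝ :=
  (((⌊cylSup A f m x / δ⌋ : ℤ) : ℝ) + 2) * δ

/-- The lower approximation `f̲_{m,δ}(x) = (⌊inf_{y∈[x]_m} f(y)/δ⌋ − 2)δ`. -/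
def fLower {a : ℕ} (A : Matrix (Fin a) (Fin a) ℕ) (f : (ℕ → Fin a) → ℝ) (m : ℕ) (δ : ℝ)
    (x : ℕ → Fin a) : ℝ :=
  (((⌊cylInf A f m x / δ⌋ : ℤ) : ℝ) - 2) * δ

/-- The discrete suspension space `Λ̃_g`. -/
def discSusp {a : ℕ} (X : Set (ℕ → Fin a)) (g : (ℕ → Fin a) → ℝ) (δ : ℝ) :
    Set ((ℕ → Fin a) × ℤ) :=
  {p | p.1 ∈ X ∧ 0 ≤ p.2 ∧ ((p.2 : ℤ) : ℝ) < g p.1 / δ}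

open Classical in
/-- The discrete suspension map `T_g`. -/
def discT {a : ℕ} (g : (ℕ → Fin a) → ℝ) (δ : ℝ) (p : (ℕ → Fin a) × ℤ) :
    (ℕ → Fin a) × ℤ :=
  if ((p.2 + 1 : ℤ) : ℝ) < g p.1 / δ then (p.1, p.2 + 1) else (shiftMap a p.1, 0)

/-- The discrete suspension measure `μ̃^g = (δ/∫g dμ)·(μ × counting)` on `Λ̃_g`. -/
def discMeasure {a : ℕ} (μ : Measure (ℕ → Fin a)) [SFinite μ] (X : Set (ℕ → Fin a))
    (g : (ℕ → Fin a) → ℝ) (δ : ℝ) : Measure ((ℕ → Fin a) × ℤ) :=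
  (ENNReal.ofReal (δ / ∫ x, g x ∂μ)) •
    ((μ.prod (Measure.count : Measure ℤ)).restrict (discSusp X g δ))

/-- Real-valued discrete non-escape quantity
`K_D(ν̃, k, H) = log ν̃{y ∈ Λ̃_g : T_g^i y ∉ H, i = 0,…,k−1}`. -/
def KDr {a : ℕ} (ν : Measure ((ℕ → Fin a) × ℤ)) (k : ℕ) (H : Set ((ℕ → Fin a) × ℤ))
    (X : Set (ℕ → Fin a)) (g : (ℕ → Fin a) → ℝ) (δ : ℝ) : ℝ :=
  Real.log (ν {p | p ∈ discSusp X g δ ∧ ∀ i < k, (discT g δ)^[i] p ∉ H}).toReal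

/-- The discrete escape rate `R_D(ν̃, H) = −limsup_{k→∞} (1/k) K_D(ν̃, k, H)`. -/
def RD {a : ℕ} (ν : Measure ((ℕ → Fin a) × ℤ)) (H : Set ((ℕ → Fin a) × ℤ))
    (X : Set (ℕ → Fin a)) (g : (ℕ → Fin a) → ℝ) (δ : ℝ) : ℝ :=
  - Filter.limsup (fun k : ℕ => KDr ν k H X g δ / (k : ℝ)) Filter.atTop

/-- Exponential growth rates are preserved when a family indexed by real time is compared with
families indexed by integer time, one time unit of the latter being `δ`. -/
lemma limsup_log_div_pinching (E : ℝ → ENNReal) (U L : ℕ → ENNReal) (cU cL : ENNReal)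
    (hcU : cU ≠ 0) (hcU' : cU ≠ ⊤) (hcL : cL ≠ 0) (hcL' : cL ≠ ⊤) (δ : ℝ) (hδ : 0 < δ)
    (hU : ∀ t, 0 ≤ t → E t ≤ cU * U ⌊t / δ⌋₊)
    (hL : ∀ t, 0 ≤ t → cL * L (⌊t / δ⌋₊ + 2) ≤ E t)
    (hUneg : limsup (fun k : ℕ => Real.log (U k).toReal / k) atTop < 0)
    (hLneg : limsup (fun k : ℕ => Real.log (L k).toReal / k) atTop < 0) :
    limsup (fun k : ℕ => Real.log (L k).toReal / k) atTop / δ ≤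
        limsup (fun t : ℝ => Real.log (E t).toReal / t) atTop ∧
      limsup (fun t : ℝ => Real.log (E t).toReal / t) atTop ≤
        limsup (fun k : ℕ => Real.log (U k).toReal / k) atTop / δ := by
  have bdd : ∀ V : ℕ → ENNReal, limsup (fun k : ℕ => Real.log (V k).toReal / k) atTop < 0 →
      IsBoundedUnder (· ≤ ·) atTop (fun k : ℕ => Real.log (V k).toReal / k) ∧
      IsCoboundedUnder (· ≤ ·) atTop (fun k : ℕ => Real.log (V k).toReal / k) ∧
      ∀ᶠ k in atTop, V k ≠ 0 ∧ V k ≠ ⊤ := by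
    intro V hV
    have h1 : IsBoundedUnder (· ≤ ·) atTop (fun k : ℕ => Real.log (V k).toReal / k) := by
      by_contra h
      have : {b : ℝ | ∀ᶠ k : ℕ in atTop, Real.log (V k).toReal / k ≤ b} = ∅ := by
        ext b
        simp only [mem_ofPred_eq, mem_empty_iff_false, iff_false]
        exact fun hb => h ⟨b, hb⟩
      rw [limsup_eq, this, Real.sInf_empty] at hV
      exact lt_irrefl _ hV
    refine ⟨h1, ?_, ?_⟩
    · by_contra h
      have : ¬ BddBelow {b : ℝ | ∀ᶠ k : ℕ in atTop, Real.log (V k).toReal / k ≤ b} := by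
        rintro ⟨b, hb⟩
        exact h ⟨b, fun c hc => hb hc⟩
      rw [limsup_eq, Real.sInf_of_not_bddBelow this] at hV
      exact lt_irrefl _ hV
    · filter_upwards [eventually_lt_of_limsup_lt hV h1] with k hk
      constructor <;> · intro h0; simp [h0] at hk
  obtain ⟨bU, -, evU⟩ := bdd U hUneg
  obtain ⟨bL, cobL, evL⟩ := bdd L hLneg
  have hfl : Tendsto (fun t : ℝ => ⌊t / δ⌋₊) atTop atTop :=
    tendsto_nat_floor_atTop.comp (tendsto_id.atTop_div_const hδ)
  have hratio : Tendsto (fun t : ℝ => (⌊t / δ⌋₊ : ℝ) / t) atTop (nhds (1 / δ)) := by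
    have := (tendsto_nat_floor_div_atTop (R := ℝ)).comp (tendsto_id.atTop_div_const hδ)
    have h2 := this.mul_const (1 / δ)
    rw [one_mul] at h2
    refine h2.congr fun t => ?_
    simp only [Function.comp, id]
    by_cases ht : t = 0
    · simp [ht]
    · field_simp
  set lU := limsup (fun k : ℕ => Real.log (U k).toReal / k) atTop with hlU
  set lL := limsup (fun k : ℕ => Real.log (L k).toReal / k) atTop with hlL
  have up : ∀ r, lU < r → ∀ᶠ t : ℝ in atTop, E t ≠ 0 →
      Real.log (E t).toReal / t ≤ Real.log cU.toReal / t + r * ((⌊t / δ⌋₊ : ℝ) / t) := by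
    intro r hr
    filter_upwards [hfl.eventually (eventually_lt_of_limsup_lt hr bU), hfl.eventually evU,
      hfl.eventually_gt_atTop 0, eventually_gt_atTop 0] with t h1 h2 h3 h4 h5
    have hk : (0 : ℝ) < (⌊t / δ⌋₊ : ℝ) := by exact_mod_cast h3
    rw [div_lt_iff₀ hk] at h1
    have hm := ENNReal.toReal_mono (ENNReal.mul_ne_top hcU' h2.2) (hU t h4.le)
    have hne : E t ≠ ⊤ := ne_top_of_le_ne_top (ENNReal.mul_ne_top hcU' h2.2) (hU t h4.le)
    have hlog := Real.log_le_log (ENNReal.toReal_pos h5 hne) hm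
    rw [ENNReal.toReal_mul, Real.log_mul (ENNReal.toReal_pos hcU hcU').ne'
      (ENNReal.toReal_pos h2.1 h2.2).ne'] at hlog
    rw [← mul_div_assoc, ← add_div]
    gcongr
    linarith
  have evE : ∀ᶠ t : ℝ in atTop, E t ≠ 0 := by
    filter_upwards [(tendsto_add_atTop_nat 2 |>.comp hfl).eventually evL,
      eventually_gt_atTop 0] with t h1 h4 h0
    have := hL t h4.le
    rw [h0, nonpos_iff_eq_zero, mul_eq_zero] at this
    exact this.elim hcL h1.1
  have evE' : ∀ᶠ t : ℝ in atTop, E t ≠ ⊤ := by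
    filter_upwards [hfl.eventually evU, eventually_gt_atTop 0] with t h2 h4
    exact ne_top_of_le_ne_top (ENNReal.mul_ne_top hcU' h2.2) (hU t h4.le)
  have hup_lim : ∀ c r : ℝ, Tendsto (fun t : ℝ => c / t + r * ((⌊t / δ⌋₊ : ℝ) / t)) atTop
      (nhds (r / δ)) := by
    intro c r
    have := (tendsto_const_nhds (x := c)).div_atTop tendsto_id |>.add (hratio.const_mul r)
    simpa [div_eq_mul_inv] using this
  have up' : ∀ r, lU < r → ∀ ε > 0, ∀ᶠ t : ℝ in atTop,
      Real.log (E t).toReal / t ≤ r / δ + ε := by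
    intro r hr ε hε
    filter_upwards [up r hr, evE, (hup_lim (Real.log cU.toReal) r).eventually_le_const
      (show r / δ < r / δ + ε by linarith)] with t h1 h2 h3
    exact (h1 h2).trans h3
  have low : ∀ r, r < lL → ∀ ε > 0, ∃ᶠ t : ℝ in atTop,
      r / δ - ε ≤ Real.log (E t).toReal / t := by
    intro r hr ε hε
    have hfreq := frequently_lt_of_lt_limsup cobL hr
    have htk : Tendsto (fun k : ℕ => ((k : ℝ) - 2) * δ) atTop atTop :=
      (tendsto_atTop_add_const_right _ (-2) tendsto_natCast_atTop_atTop).atTop_mul_const hδ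
    have hlim : Tendsto (fun k : ℕ => Real.log cL.toReal / (((k : ℝ) - 2) * δ) +
        r * (k / (((k : ℝ) - 2) * δ))) atTop (nhds (r / δ)) := by
      have h1 : Tendsto (fun k : ℕ => (k : ℝ) / (((k : ℝ) - 2) * δ)) atTop (nhds (1 / δ)) := by
        have : Tendsto (fun k : ℕ => 1 / δ + 2 / (((k : ℝ) - 2) * δ)) atTop (nhds (1 / δ)) := by
          simpa using (tendsto_const_nhds (x := 1 / δ)).add
            ((tendsto_const_nhds (x := (2 : ℝ))).div_atTop htk)
        refine this.congr' ?_
        filter_upwards [eventually_gt_atTop 2] with k hk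
        have : (2 : ℝ) < k := by exact_mod_cast hk
        have h3 : (k : ℝ) - 2 ≠ 0 := by linarith
        field_simp
        ring
      have := (tendsto_const_nhds (x := Real.log cL.toReal)).div_atTop htk |>.add
        (h1.const_mul r)
      simpa [div_eq_mul_inv] using this
    refine htk.frequently ?_
    refine (hfreq.and_eventually (evL.and ((htk.eventually evE').and
      ((hlim.eventually_const_le (show r / δ - ε < r / δ by linarith)).and
        (eventually_gt_atTop 2))))).mono ?_
    rintro k ⟨h1, h2, h3, h4, h5⟩
    have hk2 : (2 : ℝ) < k := by exact_mod_cast h5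
    have htpos : 0 < ((k : ℝ) - 2) * δ := mul_pos (by linarith) hδ
    rw [lt_div_iff₀ (by linarith)] at h1
    refine h4.trans ?_
    have hfloor : ⌊((k : ℝ) - 2) * δ / δ⌋₊ + 2 = k := by
      rw [mul_div_cancel_right₀ _ hδ.ne',
        show (k : ℝ) - 2 = ((k - 2 : ℕ) : ℝ) by rw [Nat.cast_sub h5.le]; norm_num,
        Nat.floor_natCast]
      omega
    have hE := hL _ htpos.le
    rw [hfloor] at hE
    have hm := ENNReal.toReal_mono h3 hE
    rw [ENNReal.toReal_mul] at hm
    have p1 := ENNReal.toReal_pos hcL hcL'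
    have p2 := ENNReal.toReal_pos h2.1 h2.2
    have hlog := Real.log_le_log (mul_pos p1 p2) hm
    rw [Real.log_mul p1.ne' p2.ne'] at hlog
    rw [← mul_div_assoc, ← add_div]
    gcongr
    linarith
  have bE : IsBoundedUnder (· ≤ ·) atTop (fun t : ℝ => Real.log (E t).toReal / t) :=
    ⟨_, up' (lU + 1) (by linarith) 1 one_pos⟩
  have cobE : IsCoboundedUnder (· ≤ ·) atTop (fun t : ℝ => Real.log (E t).toReal / t) :=
    IsCoboundedUnder.of_frequently_ge (low (lL - 1) (by linarith) 1 one_pos)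
  constructor
  · refine le_of_forall_pos_sub_le fun ε hε => ?_
    have := le_limsup_of_frequently_le (low (lL - ε / 2 * δ) (by
      have : 0 < ε / 2 * δ := by positivity
      linarith) (ε / 2) (by positivity)) bE
    rw [sub_div, mul_div_cancel_right₀ _ hδ.ne'] at this
    linarith
  · refine le_of_forall_pos_le_add fun ε hε => ?_
    have := limsup_le_of_le cobE (up' (lU + ε / 2 * δ) (by
      have : 0 < ε / 2 * δ := by positivity
      linarith) (ε / 2) (by positivity))
    rw [add_div, mul_div_cancel_right₀ _ hδ.ne'] at this
    linarith

lemma map_floor_volume (δ : ℝ) (hδ : 0 < δ) (b : ℤ) :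
    Measure.map (fun s : ℝ => ⌊s / δ⌋ + b) volume =
      ENNReal.ofReal δ • (Measure.count : Measure ℤ) := by
  have hmeas : Measurable (fun s : ℝ => ⌊s / δ⌋ + b) :=
    (Int.measurable_floor.comp (measurable_id.div_const δ)).add_const b
  refine Measure.ext_of_singleton fun j => ?_
  rw [Measure.map_apply hmeas (measurableSet_singleton j)]
  have : (fun s : ℝ => ⌊s / δ⌋ + b) ⁻¹' {j} = Ico ((j - b) * δ) ((j - b) * δ + δ) := by
    ext s
    simp only [mem_preimage, mem_singleton_iff, mem_Ico]
    rw [← eq_sub_iff_add_eq, Int.floor_eq_iff, le_div_iff₀ hδ, div_lt_iff₀ hδ]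
    push_cast
    constructor <;> rintro ⟨h1, h2⟩ <;> constructor <;> linarith
  rw [this, Real.volume_Ico]
  simp

lemma prod_volume_preimage_floor {Ω : Type*} [MeasurableSpace Ω] (μ : Measure Ω) [SFinite μ]
    (δ : ℝ) (hδ : 0 < δ) (b : ℤ) (D : Set (Ω × ℤ)) (hD : MeasurableSet D) :
    μ.prod volume {p : Ω × ℝ | (p.1, ⌊p.2 / δ⌋ + b) ∈ D} =
      ENNReal.ofReal δ * μ.prod (Measure.count : Measure ℤ) D := by
  have hmeas : Measurable (fun s : ℝ => ⌊s / δ⌋ + b) :=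
    (Int.measurable_floor.comp (measurable_id.div_const δ)).add_const b
  have h1 : ∀ x : Ω, volume (Prod.mk x ⁻¹' {p : Ω × ℝ | (p.1, ⌊p.2 / δ⌋ + b) ∈ D}) =
      ENNReal.ofReal δ * Measure.count (Prod.mk x ⁻¹' D) := by
    intro x
    have := congrArg (fun ν : Measure ℤ => ν (Prod.mk x ⁻¹' D)) (map_floor_volume δ hδ b)
    simp only [Measure.smul_apply, smul_eq_mul] at this
    rw [← this, Measure.map_apply hmeas (measurable_prodMk_left hD)]
    rfl
  rw [Measure.prod_apply hD, Measure.prod_apply, lintegral_congr h1,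
    lintegral_const_mul _ (measurable_measure_prodMk_left hD)]
  exact (measurable_fst.prodMk (hmeas.comp measurable_snd)) hD

section Subshift

variable {a : ℕ}

lemma measurable_of_forall_cyl_eq {m : ℕ} {g : (ℕ → Fin a) → ℝ}
    (hg : ∀ x y, (∀ i < m, x i = y i) → g x = g y) :
    Measurable g ∧ ∃ C, ∀ x, |g x| ≤ C := by
  classical
  rcases isEmpty_or_nonempty (ℕ → Fin a) with h | ⟨⟨x₀⟩⟩
  · exact ⟨measurable_of_empty g, 0, fun x => h.elim x⟩
  let e : (Fin m → Fin a) → (ℕ → Fin a) := fun w i => if h : i < m then w ⟨i, h⟩ else x₀ i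
  let r : (ℕ → Fin a) → (Fin m → Fin a) := fun x i => x i
  have hfac : ∀ x, g x = (g ∘ e) (r x) := fun x => hg _ _ fun i hi => by simp [e, r, hi]
  constructor
  · have hr : Measurable r := measurable_pi_lambda _ fun i => measurable_pi_apply _
    have : g = (g ∘ e) ∘ r := funext hfac
    rw [this]
    exact (measurable_of_finite (g ∘ e)).comp hr
  · obtain ⟨C, hC⟩ := (Set.finite_range fun w => |(g ∘ e) w|).bddAbove
    exact ⟨C, fun x => by rw [hfac]; exact hC ⟨r x, rfl⟩⟩

lemma cyl_congr {m : ℕ} {x y : ℕ → Fin a} (h : ∀ i < m, x i = y i) : cyl x m = cyl y m := by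
  ext w
  exact forall₂_congr fun i hi => by rw [h i hi]

lemma measurable_shiftMap : Measurable (shiftMap a) :=
  measurable_pi_lambda _ fun i => measurable_pi_apply (i + 1)

lemma measurableSet_SFT (A : Matrix (Fin a) (Fin a) ℕ) : MeasurableSet (SFT A) := by
  have : SFT A = ⋂ n, {x : ℕ → Fin a | A (x n) (x (n + 1)) = 1} := by
    ext x
    simp [SFT]
  rw [this]
  refine MeasurableSet.iInter fun n => ?_
  have h : Measurable fun x : ℕ → Fin a => (x n, x (n + 1)) :=
    (measurable_pi_apply n).prodMk (measurable_pi_apply (n + 1))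
  exact h (MeasurableSet.of_discrete (s := {p : Fin a × Fin a | A p.1 p.2 = 1}))

lemma measurableSet_cyl (x : ℕ → Fin a) (n : ℕ) : MeasurableSet (cyl x n) := by
  have : cyl x n = ⋂ i, ⋂ _ : i < n, {y : ℕ → Fin a | y i = x i} := by
    ext y
    simp [cyl]
  rw [this]
  exact MeasurableSet.iInter fun i => MeasurableSet.iInter fun _ =>
    measurableSet_eq_fun (measurable_pi_apply i) measurable_const

lemma iterate_shiftMap_mem_SFT {A : Matrix (Fin a) (Fin a) ℕ} {x : ℕ → Fin a}
    (hx : x ∈ SFT A) (k : ℕ) : (shiftMap a)^[k] x ∈ SFT A := by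
  induction k with
  | zero => exact hx
  | succ k ih =>
    rw [Function.iterate_succ_apply']
    exact fun n => ih (n + 1)

lemma birkhoff_succ (f : (ℕ → Fin a) → ℝ) (k : ℕ) (x : ℕ → Fin a) :
    birkhoff f (k + 1) x = birkhoff f k x + f ((shiftMap a)^[k] x) :=
  Finset.sum_range_succ _ _

lemma birkhoff_mono {A : Matrix (Fin a) (Fin a) ℕ} {f : (ℕ → Fin a) → ℝ}
    (hf : ∀ x ∈ SFT A, 0 < f x) {x : ℕ → Fin a} (hx : x ∈ SFT A) :
    StrictMono fun k => birkhoff f k x := by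
  refine strictMono_nat_of_lt_succ fun k => ?_
  rw [birkhoff_succ]
  linarith [hf _ (iterate_shiftMap_mem_SFT hx k)]

lemma le_birkhoff {A : Matrix (Fin a) (Fin a) ℕ} {f : (ℕ → Fin a) → ℝ}
    (hf : ∀ x ∈ SFT A, 0 < f x) {x : ℕ → Fin a} (hx : x ∈ SFT A) {k : ℕ} (hk : 0 < k) :
    f x ≤ birkhoff f k x := by
  have := (birkhoff_mono hf hx).monotone hk
  simpa [birkhoff] using this

/-- An orbit segment of the semi-flow avoids `I × {0}` iff its returns to the base avoid `I`. -/
lemma susFlow_notMem_iff {A : Matrix (Fin a) (Fin a) ℕ} {f : (ℕ → Fin a) → ℝ}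
    (hf : ∀ x ∈ SFT A, 0 < f x) (I : Set (ℕ → Fin a)) {t s : ℝ} (ht : 0 ≤ t)
    {x : ℕ → Fin a} (hx : x ∈ SFT A) :
    (∀ r ∈ Icc (0 : ℝ) t, susFlow f r (x, s) ∉ I ×ˢ ({0} : Set ℝ)) ↔
      ∀ k, 0 ≤ birkhoff f k x - s → birkhoff f k x - s ≤ t → (shiftMap a)^[k] x ∉ I := by
  have mono := birkhoff_mono hf hx
  constructor
  · intro h k h0 h1 hk
    refine h _ ⟨h0, h1⟩ ?_
    have hex : ∃ n : ℕ, birkhoff f n x ≤ s + (birkhoff f k x - s) ∧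
        s + (birkhoff f k x - s) < birkhoff f (n + 1) x :=
      ⟨k, by linarith, by linarith [mono (Nat.lt_succ_self k)]⟩
    have hck : hex.choose = k := by
      have hs := hex.choose_spec
      have h2 : hex.choose ≤ k := mono.le_iff_le.1
        (show birkhoff f hex.choose x ≤ birkhoff f k x by linarith [hs.1])
      have h3 : k < hex.choose + 1 := mono.lt_iff_lt.1
        (show birkhoff f k x < birkhoff f (hex.choose + 1) x by linarith [hs.2])
      omega
    rw [susFlow, dif_pos hex]
    refine ⟨?_, ?_⟩
    · show (shiftMap a)^[hex.choose] x ∈ I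
      rwa [hck]
    · show s + (birkhoff f k x - s) - birkhoff f hex.choose x = 0
      rw [hck]
      ring
  · intro h r hr hmem
    rw [susFlow] at hmem
    split_ifs at hmem with hex
    · have h2 : s + r - birkhoff f hex.choose x = 0 := hmem.2
      exact h hex.choose (by linarith [hr.1]) (by linarith [hr.2]) hmem.1
    · have h2 : s = 0 := hmem.2
      exact h 0 (by simp [birkhoff, h2]) (by simpa [birkhoff, h2] using ht) hmem.1

lemma exists_discT_iterate {A : Matrix (Fin a) (Fin a) ℕ} {g : (ℕ → Fin a) → ℝ} {δ : ℝ}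
    (hδ : 0 < δ) (hg : ∀ x ∈ SFT A, 0 < g x) (hint : ∀ x, ∃ N : ℤ, g x = N * δ)
    {x : ℕ → Fin a} {j : ℤ} (hxj : (x, j) ∈ discSusp (SFT A) g δ) (i : ℕ) :
    ∃ k : ℕ, ∃ l : ℤ, (discT g δ)^[i] (x, j) = ((shiftMap a)^[k] x, l) ∧ 0 ≤ l ∧
      l * δ < g ((shiftMap a)^[k] x) ∧ birkhoff g k x + l * δ = (j + i) * δ := by
  induction i with
  | zero =>
    refine ⟨0, j, rfl, hxj.2.1, (lt_div_iff₀ hδ).1 hxj.2.2, ?_⟩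
    simp [birkhoff]
  | succ i ih =>
    obtain ⟨k, l, h1, h2, h3, h4⟩ := ih
    obtain ⟨N, hN⟩ := hint ((shiftMap a)^[k] x)
    rw [Function.iterate_succ_apply', h1, discT]
    split_ifs with hlt
    · refine ⟨k, l + 1, rfl, by omega, (lt_div_iff₀ hδ).1 hlt, ?_⟩
      push_cast
      linarith
    · refine ⟨k + 1, 0, ?_, le_rfl, ?_, ?_⟩
      · rw [Function.iterate_succ_apply']
      · simpa using hg _ (iterate_shiftMap_mem_SFT hxj.1 (k + 1))
      · have hl : l + 1 = N := by
          rw [hN] at h3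
          have h5 : l < N := by exact_mod_cast lt_of_mul_lt_mul_right h3 hδ.le
          simp only [hN, mul_div_cancel_right₀ _ hδ.ne', Int.cast_lt] at hlt
          omega
        rw [birkhoff_succ, hN, ← hl]
        push_cast
        linarith

/-- An orbit segment of the tower map avoids `I × {0}` iff its returns to the base avoid `I`. -/
lemma discT_iterate_notMem_iff {A : Matrix (Fin a) (Fin a) ℕ} {g : (ℕ → Fin a) → ℝ} {δ : ℝ}
    (hδ : 0 < δ) (hg : ∀ x ∈ SFT A, 0 < g x) (hint : ∀ x, ∃ N : ℤ, g x = N * δ)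
    (I : Set (ℕ → Fin a)) {x : ℕ → Fin a} {j : ℤ} (hxj : (x, j) ∈ discSusp (SFT A) g δ)
    (n : ℕ) :
    (∀ i < n, (discT g δ)^[i] (x, j) ∉ I ×ˢ ({0} : Set ℤ)) ↔
      ∀ k, j * δ ≤ birkhoff g k x → birkhoff g k x < (j + n) * δ → (shiftMap a)^[k] x ∉ I := by
  have mono := birkhoff_mono hg hxj.1
  constructor
  · intro h k h0 h1 hk
    obtain ⟨N, hN⟩ : ∃ N : ℤ, birkhoff g k x = N * δ := by
      choose F hF using hint
      refine ⟨∑ i ∈ Finset.range k, F ((shiftMap a)^[i] x), ?_⟩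
      rw [birkhoff, Int.cast_sum, Finset.sum_mul]
      exact Finset.sum_congr rfl fun i _ => hF _
    rw [hN] at h0 h1
    have hjN : j ≤ N := by exact_mod_cast le_of_mul_le_mul_right h0 hδ
    have hNn : N < j + n := by exact_mod_cast lt_of_mul_lt_mul_right h1 hδ.le
    obtain ⟨i, hi⟩ := Int.eq_ofNat_of_zero_le (sub_nonneg.2 hjN)
    obtain ⟨k', l, e1, e2, e3, e4⟩ := exists_discT_iterate hδ hg hint hxj i
    have hji : (j : ℝ) + i = N := by
      have : j + i = N := by omega
      exact_mod_cast this
    rw [hji, ← hN] at e4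
    have hl0 : 0 ≤ (l : ℝ) * δ := mul_nonneg (by exact_mod_cast e2) hδ.le
    have hk1 : k' ≤ k := mono.le_iff_le.1 (by show birkhoff g k' x ≤ birkhoff g k x; linarith)
    have hk2 : k < k' + 1 := mono.lt_iff_lt.1 (by
      show birkhoff g k x < birkhoff g (k' + 1) x
      rw [birkhoff_succ]; linarith)
    obtain rfl : k' = k := by omega
    have hl : l = 0 := by
      have : (l : ℝ) * δ = 0 := by linarith
      simpa [hδ.ne'] using this
    refine h i (by omega) ?_
    rw [e1]
    exact ⟨hk, hl⟩
  · intro h i hi hmem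
    obtain ⟨k, l, e1, -, -, e4⟩ := exists_discT_iterate hδ hg hint hxj i
    rw [e1] at hmem
    have hl : l = 0 := hmem.2
    rw [hl, Int.cast_zero, zero_mul, add_zero] at e4
    have hir : (i : ℝ) < n := by exact_mod_cast hi
    refine h k ?_ ?_ hmem.1
    · rw [e4]
      have : (0 : ℝ) ≤ i := Nat.cast_nonneg i
      gcongr
      linarith
    · rw [e4]
      gcongr

lemma measurableSet_discSusp (A : Matrix (Fin a) (Fin a) ℕ) {g : (ℕ → Fin a) → ℝ}
    (hg : Measurable g) (δ : ℝ) : MeasurableSet (discSusp (SFT A) g δ) :=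
  (measurable_fst (measurableSet_SFT A)).inter
    ((measurableSet_le measurable_const measurable_snd).inter
      (measurableSet_lt (measurable_from_top.comp measurable_snd)
        ((hg.comp measurable_fst).div_const δ)))

lemma measurable_discT {g : (ℕ → Fin a) → ℝ} (hg : Measurable g) (δ : ℝ) :
    Measurable (discT g δ) := by
  refine Measurable.ite ?_ (measurable_fst.prodMk (measurable_snd.add_const 1))
    ((measurable_shiftMap.comp measurable_fst).prodMk measurable_const)
  exact measurableSet_lt
    (measurable_from_top.comp (measurable_snd.add_const (1 : ℤ)))
    ((hg.comp measurable_fst).div_const δ)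

lemma measurableSet_discSurvivor (A : Matrix (Fin a) (Fin a) ℕ) {g : (ℕ → Fin a) → ℝ}
    (hg : Measurable g) (δ : ℝ) {I : Set (ℕ → Fin a)} (hI : MeasurableSet I) (n : ℕ) :
    MeasurableSet {p | p ∈ discSusp (SFT A) g δ ∧
      ∀ i < n, (discT g δ)^[i] p ∉ I ×ˢ ({0} : Set ℤ)} := by
  have : {p | p ∈ discSusp (SFT A) g δ ∧
      ∀ i < n, (discT g δ)^[i] p ∉ I ×ˢ ({0} : Set ℤ)} =
      discSusp (SFT A) g δ ∩
        ⋂ i, ⋂ _ : i < n, (discT g δ)^[i] ⁻¹' (I ×ˢ ({0} : Set ℤ))ᶜ := by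
    ext p
    simp
  rw [this]
  exact (measurableSet_discSusp A hg δ).inter (MeasurableSet.iInter fun i =>
    MeasurableSet.iInter fun _ => (measurable_discT hg δ).iterate i
      (hI.prod (measurableSet_singleton 0)).compl)

lemma suspMeasure_apply (μ : Measure (ℕ → Fin a)) [SFinite μ] (X : Set (ℕ → Fin a))
    (f : (ℕ → Fin a) → ℝ) {E : Set ((ℕ → Fin a) × ℝ)} (hE : E ⊆ susp X f) :
    suspMeasure μ X f E = (ENNReal.ofReal (∫ x, f x ∂μ))⁻¹ * μ.prod volume E := by
  rw [suspMeasure, Measure.smul_apply, Measure.restrict_eq_self _ hE, smul_eq_mul]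

lemma discMeasure_apply (μ : Measure (ℕ → Fin a)) [SFinite μ] (X : Set (ℕ → Fin a))
    (g : (ℕ → Fin a) → ℝ) (δ : ℝ) {D : Set ((ℕ → Fin a) × ℤ)} (hD : D ⊆ discSusp X g δ) :
    discMeasure μ X g δ D =
      ENNReal.ofReal (δ / ∫ x, g x ∂μ) * μ.prod (Measure.count : Measure ℤ) D := by
  rw [discMeasure, Measure.smul_apply, Measure.restrict_eq_self _ hD, smul_eq_mul]

lemma ofReal_mul_prod_count (μ : Measure (ℕ → Fin a)) [SFinite μ] {X : Set (ℕ → Fin a)}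
    {g : (ℕ → Fin a) → ℝ} {δ : ℝ} (hg : 0 < ∫ x, g x ∂μ)
    {D : Set ((ℕ → Fin a) × ℤ)} (hD : D ⊆ discSusp X g δ) :
    ENNReal.ofReal δ * μ.prod (Measure.count : Measure ℤ) D =
      ENNReal.ofReal (∫ x, g x ∂μ) * discMeasure μ X g δ D := by
  rw [discMeasure_apply μ X g δ hD, ← mul_assoc, ← ENNReal.ofReal_mul hg.le,
    mul_div_cancel₀ _ hg.ne']

lemma discMeasure_base_toReal (μ : Measure (ℕ → Fin a)) [SFinite μ]
    {A : Matrix (Fin a) (Fin a) ℕ} {g : (ℕ → Fin a) → ℝ} {δ : ℝ} (hδ : 0 < δ)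
    (hg : ∀ x ∈ SFT A, 0 < g x) (hgint : 0 < ∫ x, g x ∂μ) {I : Set (ℕ → Fin a)}
    (hI : I ⊆ SFT A) :
    (discMeasure μ (SFT A) g δ (I ×ˢ ({0} : Set ℤ))).toReal =
      δ / (∫ x, g x ∂μ) * (μ I).toReal := by
  rw [discMeasure_apply]
  · rw [Measure.prod_prod, Measure.count_singleton, mul_one, ENNReal.toReal_mul,
      ENNReal.toReal_ofReal (by positivity)]
  · rintro ⟨x, j⟩ ⟨hx, hj⟩
    obtain rfl : j = 0 := hj
    exact ⟨hI hx, le_rfl, by simpa using div_pos (hg x (hI hx)) hδ⟩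

lemma suspSurvivor_subset {A : Matrix (Fin a) (Fin a) ℕ} {f g : (ℕ → Fin a) → ℝ} {δ : ℝ}
    (hδ : 0 < δ) (hf : ∀ x ∈ SFT A, 0 < f x) (hfg : ∀ x ∈ SFT A, f x + δ ≤ g x)
    (hint : ∀ x, ∃ N : ℤ, g x = N * δ) (I : Set (ℕ → Fin a)) {t : ℝ} (ht : 0 ≤ t) :
    {p | p ∈ susp (SFT A) f ∧ ∀ s ∈ Icc (0 : ℝ) t, susFlow f s p ∉ I ×ˢ ({0} : Set ℝ)} ⊆
      {p | (p.1, ⌊p.2 / δ⌋ + 1) ∈ {q | q ∈ discSusp (SFT A) g δ ∧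
        ∀ i < ⌊t / δ⌋₊, (discT g δ)^[i] q ∉ I ×ˢ ({0} : Set ℤ)}} := by
  rintro ⟨x, s⟩ ⟨⟨hx, hs0, hs⟩, hflow⟩
  replace hx : x ∈ SFT A := hx
  replace hs0 : 0 ≤ s := hs0
  replace hs : s < f x := hs
  have hg : ∀ x ∈ SFT A, 0 < g x := fun x hx => by linarith [hf x hx, hfg x hx]
  have hj0 : 0 ≤ ⌊s / δ⌋ := Int.floor_nonneg.2 (div_nonneg hs0 hδ.le)
  have hj1 : (⌊s / δ⌋ : ℝ) * δ ≤ s := (le_div_iff₀ hδ).1 (Int.floor_le _)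
  have hK : (⌊t / δ⌋₊ : ℝ) * δ ≤ t :=
    (le_div_iff₀ hδ).1 (Nat.floor_le (div_nonneg ht hδ.le))
  have hD : (x, ⌊s / δ⌋ + 1) ∈ discSusp (SFT A) g δ := by
    refine ⟨hx, by show 0 ≤ ⌊s / δ⌋ + 1; omega, ?_⟩
    rw [lt_div_iff₀ hδ]
    push_cast
    linarith [hfg x hx]
  refine ⟨hD, (discT_iterate_notMem_iff hδ hg hint I hD _).2 fun k h0 h1 => ?_⟩
  push_cast at h0 h1
  rcases Nat.eq_zero_or_pos k with rfl | hk
  · have : 0 ≤ (⌊s / δ⌋ : ℝ) * δ := mul_nonneg (by exact_mod_cast hj0) hδ.le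
    simp only [birkhoff, Finset.range_zero, Finset.sum_empty] at h0
    linarith
  · have hcmp : birkhoff f k x + δ ≤ birkhoff g k x := by
      induction k, hk using Nat.le_induction with
      | base => simpa [birkhoff] using hfg x hx
      | succ k hk ih =>
        have h2 : ∀ k : ℕ, birkhoff f k x ≤ birkhoff g k x := fun k =>
          Finset.sum_le_sum fun i _ => by
            linarith [hfg _ (iterate_shiftMap_mem_SFT hx i)]
        rw [birkhoff_succ, birkhoff_succ]
        linarith [hfg _ (iterate_shiftMap_mem_SFT hx k), h2 k]
    refine (susFlow_notMem_iff hf I ht hx).1 hflow k ?_ ?_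
    · linarith [le_birkhoff hf hx hk]
    · linarith

lemma discSurvivor_subset {A : Matrix (Fin a) (Fin a) ℕ} {f g : (ℕ → Fin a) → ℝ} {δ : ℝ}
    (hδ : 0 < δ) (hg : ∀ x ∈ SFT A, 0 < g x) (hgf : ∀ x ∈ SFT A, g x ≤ f x)
    (hint : ∀ x, ∃ N : ℤ, g x = N * δ) (I : Set (ℕ → Fin a)) {t : ℝ} (ht : 0 ≤ t) :
    {p | (p.1, ⌊p.2 / δ⌋ + 0) ∈ {q | q ∈ discSusp (SFT A) g δ ∧
        ∀ i < ⌊t / δ⌋₊ + 2, (discT g δ)^[i] q ∉ I ×ˢ ({0} : Set ℤ)}} ⊆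
      {p | p ∈ susp (SFT A) f ∧ ∀ s ∈ Icc (0 : ℝ) t, susFlow f s p ∉ I ×ˢ ({0} : Set ℝ)} := by
  rintro ⟨x, s⟩ ⟨hD, hdisc⟩
  rw [add_zero] at hD hdisc
  dsimp only at hD hdisc
  rw [discT_iterate_notMem_iff hδ hg hint I hD] at hdisc
  have hx : x ∈ SFT A := hD.1
  have hj0 : 0 ≤ ⌊s / δ⌋ := hD.2.1
  have hs0 : 0 ≤ s := by
    have := mul_nonneg (Int.floor_nonneg.1 hj0) hδ.le
    rwa [div_mul_cancel₀ _ hδ.ne'] at this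
  have hj1 : (⌊s / δ⌋ : ℝ) * δ ≤ s := (le_div_iff₀ hδ).1 (Int.floor_le _)
  have hj2 : s < ((⌊s / δ⌋ : ℝ) + 1) * δ := (div_lt_iff₀ hδ).1 (Int.lt_floor_add_one _)
  have hK : t < ((⌊t / δ⌋₊ : ℝ) + 1) * δ := (div_lt_iff₀ hδ).1 (Nat.lt_floor_add_one _)
  have hsg : s < g x := by
    obtain ⟨N, hN⟩ := hint x
    have h1 : ((⌊s / δ⌋ : ℤ) : ℝ) < g x / δ := hD.2.2
    rw [hN, mul_div_cancel_right₀ _ hδ.ne', Int.cast_lt] at h1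
    have h2 : (⌊s / δ⌋ : ℝ) + 1 ≤ N := by exact_mod_cast h1
    rw [hN]
    exact hj2.trans_le (mul_le_mul_of_nonneg_right h2 hδ.le)
  have hf : ∀ x ∈ SFT A, 0 < f x := fun x hx => (hg x hx).trans_le (hgf x hx)
  refine ⟨⟨hx, hs0, hsg.trans_le (hgf x hx)⟩,
    (susFlow_notMem_iff hf I ht hx).2 fun k h0 h1 => hdisc k ?_ ?_⟩
  · rcases Nat.eq_zero_or_pos k with rfl | hk
    · simp only [birkhoff, Finset.range_zero, Finset.sum_empty] at h0 ⊢
      linarith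
    · linarith [le_birkhoff hg hx hk]
  · have hcmp : birkhoff g k x ≤ birkhoff f k x :=
      Finset.sum_le_sum fun i _ => hgf _ (iterate_shiftMap_mem_SFT hx i)
    push_cast
    linarith

/-- A roof function pinched between two `δℤ`-valued ones has its escape rate pinched by the
corresponding discrete rates. -/
lemma Rc_pinching (μ : Measure (ℕ → Fin a)) [SFinite μ]
    {A : Matrix (Fin a) (Fin a) ℕ} {f u l : (ℕ → Fin a) → ℝ} {δ : ℝ} (hδ : 0 < δ)
    (hl : ∀ x ∈ SFT A, 0 < l x) (hlf : ∀ x ∈ SFT A, l x ≤ f x)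
    (hfu : ∀ x ∈ SFT A, f x + δ ≤ u x)
    (hintl : ∀ x, ∃ N : ℤ, l x = N * δ) (hintu : ∀ x, ∃ N : ℤ, u x = N * δ)
    (hml : Measurable l) (hmu : Measurable u)
    (hIl : 0 < ∫ x, l x ∂μ) (hIf : 0 < ∫ x, f x ∂μ) (hIu : 0 < ∫ x, u x ∂μ)
    {I : Set (ℕ → Fin a)} (hI : MeasurableSet I)
    (hRl : 0 < RD (discMeasure μ (SFT A) l δ) (I ×ˢ ({0} : Set ℤ)) (SFT A) l δ)
    (hRu : 0 < RD (discMeasure μ (SFT A) u δ) (I ×ˢ ({0} : Set ℤ)) (SFT A) u δ) :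
    RD (discMeasure μ (SFT A) u δ) (I ×ˢ ({0} : Set ℤ)) (SFT A) u δ / δ ≤
        Rc (suspMeasure μ (SFT A) f) (I ×ˢ ({0} : Set ℝ)) (SFT A) f ∧
      Rc (suspMeasure μ (SFT A) f) (I ×ˢ ({0} : Set ℝ)) (SFT A) f ≤
        RD (discMeasure μ (SFT A) l δ) (I ×ˢ ({0} : Set ℤ)) (SFT A) l δ / δ := by
  have hf : ∀ x ∈ SFT A, 0 < f x := fun x hx => (hl x hx).trans_le (hlf x hx)
  have hcf0 : (ENNReal.ofReal (∫ x, f x ∂μ))⁻¹ ≠ 0 := ENNReal.inv_ne_zero.2 ENNReal.ofReal_ne_top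
  have hcf1 : (ENNReal.ofReal (∫ x, f x ∂μ))⁻¹ ≠ ⊤ :=
    ENNReal.inv_ne_top.2 (ENNReal.ofReal_pos.2 hIf).ne'
  have key := limsup_log_div_pinching
    (fun t => suspMeasure μ (SFT A) f {p | p ∈ susp (SFT A) f ∧
      ∀ s ∈ Icc (0 : ℝ) t, susFlow f s p ∉ I ×ˢ ({0} : Set ℝ)})
    (fun k => discMeasure μ (SFT A) u δ {p | p ∈ discSusp (SFT A) u δ ∧
      ∀ i < k, (discT u δ)^[i] p ∉ I ×ˢ ({0} : Set ℤ)})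
    (fun k => discMeasure μ (SFT A) l δ {p | p ∈ discSusp (SFT A) l δ ∧
      ∀ i < k, (discT l δ)^[i] p ∉ I ×ˢ ({0} : Set ℤ)})
    ((ENNReal.ofReal (∫ x, f x ∂μ))⁻¹ * ENNReal.ofReal (∫ x, u x ∂μ))
    ((ENNReal.ofReal (∫ x, f x ∂μ))⁻¹ * ENNReal.ofReal (∫ x, l x ∂μ))
    (mul_ne_zero hcf0 (ENNReal.ofReal_pos.2 hIu).ne')
    (ENNReal.mul_ne_top hcf1 ENNReal.ofReal_ne_top)
    (mul_ne_zero hcf0 (ENNReal.ofReal_pos.2 hIl).ne')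
    (ENNReal.mul_ne_top hcf1 ENNReal.ofReal_ne_top) δ hδ
    (fun t ht => by
      rw [suspMeasure_apply _ _ _ fun p hp => hp.1, mul_assoc,
        ← ofReal_mul_prod_count μ hIu fun p hp => hp.1,
        ← prod_volume_preimage_floor μ δ hδ 1 _ (measurableSet_discSurvivor A hmu δ hI _)]
      exact mul_le_mul_of_nonneg_left (measure_mono (suspSurvivor_subset hδ hf hfu hintu I ht))
        zero_le)
    (fun t ht => by
      rw [suspMeasure_apply _ _ _ fun p hp => hp.1, mul_assoc,
        ← ofReal_mul_prod_count μ hIl fun p hp => hp.1,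
        ← prod_volume_preimage_floor μ δ hδ 0 _ (measurableSet_discSurvivor A hml δ hI _)]
      exact mul_le_mul_of_nonneg_left (measure_mono (discSurvivor_subset hδ hl hlf hintl I ht))
        zero_le)
    (neg_pos.1 hRu) (neg_pos.1 hRl)
  rw [RD, Rc, RD, neg_div, neg_div]
  exact ⟨neg_le_neg key.2, neg_le_neg key.1⟩

lemma birkhoff_mul_of_iterate_eq (φ : (ℕ → Fin a) → ℝ) {p : ℕ} {z : ℕ → Fin a}
    (hp : (shiftMap a)^[p] z = z) (k : ℕ) : birkhoff φ (k * p) z = k * birkhoff φ p z := by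
  induction k with
  | zero => simp [birkhoff]
  | succ k ih =>
    have hz : (shiftMap a)^[k * p] z = z :=
      (show Function.IsPeriodicPt (shiftMap a) p z from hp).const_mul k
    have := birkhoffSum_add (shiftMap a) φ (k * p) p z
    rw [hz] at this
    rw [Nat.succ_mul]
    refine (this.trans ?_)
    push_cast
    rw [add_mul, one_mul, ← ih]
    rfl

/-- The measure of the sets shrinking to `z` tends to zero, so along a periodic orbit the
Gibbs weights must decay. -/
lemma birkhoff_lt_of_periodic {A : Matrix (Fin a) (Fin a) ℕ} {φ : (ℕ → Fin a) → ℝ}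
    {μ : Measure (ℕ → Fin a)} [IsFiniteMeasure μ] {P c₁ : ℝ} (hc₁ : 0 < c₁)
    {z : ℕ → Fin a}
    (hGibbs : ∀ n : ℕ, 1 ≤ n →
      c₁ ≤ (μ (SFT A ∩ cyl z n)).toReal / Real.exp (-P * n + birkhoff φ n z))
    {I : ℕ → Set (ℕ → Fin a)} (hI : ∀ n, 1 ≤ n → SFT A ∩ cyl z n ⊆ I n)
    {c ρ : ℝ} (hc : 0 < c) (hρ0 : 0 < ρ) (hρ1 : ρ < 1)
    (hdecay : ∀ n, 1 ≤ n → μ (I n) ≤ ENNReal.ofReal (c * ρ ^ n))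
    {p : ℕ} (hp0 : 0 < p) (hp : (shiftMap a)^[p] z = z) :
    birkhoff φ p z - p * P < 0 := by
  by_contra! hcon
  have hlim : Tendsto (fun n : ℕ => c * ρ ^ n) atTop (nhds 0) := by
    simpa using (tendsto_pow_atTop_nhds_zero_of_lt_one hρ0.le hρ1).const_mul c
  obtain ⟨n, hn⟩ := eventually_atTop.1 (hlim.eventually_lt_const hc₁)
  have hge : n + 1 ≤ (n + 1) * p := Nat.le_mul_of_pos_right _ hp0
  have h1 := hGibbs ((n + 1) * p) (by omega)
  rw [birkhoff_mul_of_iterate_eq φ hp, le_div_iff₀ (Real.exp_pos _)] at h1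
  have h2 : 1 ≤ Real.exp (-P * ((n + 1) * p : ℕ) + (n + 1 : ℕ) * birkhoff φ p z) := by
    rw [Real.one_le_exp_iff]
    push_cast
    nlinarith [mul_nonneg (by positivity : (0 : ℝ) ≤ (n : ℝ) + 1) hcon]
  have h3 : (μ (SFT A ∩ cyl z ((n + 1) * p))).toReal ≤ c * ρ ^ ((n + 1) * p) :=
    ENNReal.toReal_le_of_le_ofReal (by positivity)
      ((measure_mono (hI _ (by omega))).trans (hdecay _ (by omega)))
  have h4 := hn ((n + 1) * p) (by omega)
  nlinarith [le_mul_of_one_le_right hc₁.le h2]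

lemma one_le_integral_of_cyl {A : Matrix (Fin a) (Fin a) ℕ} (μ : Measure (ℕ → Fin a))
    [IsProbabilityMeasure μ] (hsupp : μ (SFT A) = 1) {m : ℕ} {g : (ℕ → Fin a) → ℝ}
    (hg : ∀ x y, (∀ i < m, x i = y i) → g x = g y) (h1 : ∀ x ∈ SFT A, 1 ≤ g x) :
    1 ≤ ∫ x, g x ∂μ := by
  obtain ⟨hm, C, hC⟩ := measurable_of_forall_cyl_eq hg
  have hint : Integrable g μ :=
    Integrable.of_bound hm.aestronglyMeasurable C (Eventually.of_forall hC)
  have hae : ∀ᵐ x ∂μ, x ∈ SFT A := mem_ae_iff_prob_eq_one (measurableSet_SFT A) |>.2 hsupp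
  have := integral_mono_ae (integrable_const (1 : ℝ)) hint (hae.mono h1)
  simpa using this

end Subshift

/-- If the discrete escape-rate limits hold for the two discretised
systems built from the upper and lower approximations `f̄_{m,δ}` and `f̲_{m,δ}` of the roof
function `f`, then the continuous escape rate of the suspension flow is asymptotically
pinched between `γ(z)/∫f̄ dμ` and `γ(z)/∫f̲ dμ`. -/
theorem escape_rate_pinching
    (a : ℕ) (ha : 2 ≤ a) (A : Matrix (Fin a) (Fin a) ℕ)
    (hA01 : ∀ i j, A i j = 0 ∨ A i j = 1)
    (hAper : ∃ d : ℕ, 0 < d ∧ ∀ i j, 0 < (A ^ d) i j)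
    (θ : ℝ) (hθ : θ ∈ Set.Ioo (0 : ℝ) 1)
    (φ : (ℕ → Fin a) → ℝ)
    (hφLip : ∃ L : ℝ, ∀ x ∈ SFT A, ∀ y ∈ SFT A, ∀ n : ℕ,
        (∀ i < n, x i = y i) → |φ x - φ y| ≤ L * θ ^ n)
    (μ : Measure (ℕ → Fin a)) [IsProbabilityMeasure μ]
    (hsupp : μ (SFT A) = 1)
    (hinv : ∀ B : Set (ℕ → Fin a), MeasurableSet B → μ (shiftMap a ⁻¹' B) = μ B)
    (P : ℝ) (hP : 0 ≤ P) (c₁ c₂ : ℝ) (hc₁ : 0 < c₁) (hc₂ : 0 < c₂)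
    (hGibbs : ∀ x ∈ SFT A, ∀ n : ℕ, 1 ≤ n →
        c₁ ≤ (μ (SFT A ∩ cyl x n)).toReal / Real.exp (-P * n + birkhoff φ n x) ∧
        (μ (SFT A ∩ cyl x n)).toReal / Real.exp (-P * n + birkhoff φ n x) ≤ c₂)
    (f : (ℕ → Fin a) → ℝ) (hf1 : ∀ x ∈ SFT A, 1 < f x)
    (hfLip : ∃ L : ℝ, ∀ x ∈ SFT A, ∀ y ∈ SFT A, ∀ n : ℕ,
        (∀ i < n, x i = y i) → |f x - f y| ≤ L * θ ^ n)
    (I : ℕ → Set (ℕ → Fin a)) (z : ℕ → Fin a) (hz : z ∈ SFT A)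
    (hnested : NestedCondition A μ I z)
    (δ : ℝ) (hδ : 0 < δ) (m : ℕ) (hm : 0 < m)
    (hgl0 : ∀ x ∈ SFT A, 0 < fLower A f m δ x)
    (hsandwich : ∀ x ∈ SFT A, fLower A f m δ x ≤ f x ∧ f x ≤ fUpper A f m δ x)
    (hIntl : (1 / 2 : ℝ) * ∫ x, f x ∂μ ≤ ∫ x, fLower A f m δ x ∂μ)
    (hIntu : ∫ x, fUpper A f m δ x ∂μ ≤ 2 * ∫ x, f x ∂μ)
    (γz : ℝ)
    (hγ1 : (∀ p : ℕ, 0 < p → (shiftMap a)^[p] z ≠ z) → γz = 1)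
    (hγ2 : ∀ p : ℕ, 0 < p → (shiftMap a)^[p] z = z →
        (∀ q : ℕ, 0 < q → (shiftMap a)^[q] z = z → p ≤ q) →
        γz = 1 - Real.exp (birkhoff φ p z - p * P))
    (hdiscU : Tendsto (fun n : ℕ =>
        RD (discMeasure μ (SFT A) (fUpper A f m δ) δ) ((I n) ×ˢ ({0} : Set ℤ))
            (SFT A) (fUpper A f m δ) δ /
          ((discMeasure μ (SFT A) (fUpper A f m δ) δ) ((I n) ×ˢ ({0} : Set ℤ))).toReal)
        atTop (nhds γz))
    (hdiscL : Tendsto (fun n : ℕ =>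
        RD (discMeasure μ (SFT A) (fLower A f m δ) δ) ((I n) ×ˢ ({0} : Set ℤ))
            (SFT A) (fLower A f m δ) δ /
          ((discMeasure μ (SFT A) (fLower A f m δ) δ) ((I n) ×ˢ ({0} : Set ℤ))).toReal)
        atTop (nhds γz)) :
    γz / (∫ x, fUpper A f m δ x ∂μ) ≤
        Filter.liminf (fun n : ℕ =>
          Rc (suspMeasure μ (SFT A) f) ((I n) ×ˢ ({0} : Set ℝ)) (SFT A) f /
            (μ (I n)).toReal) Filter.atTop ∧
      Filter.limsup (fun n : ℕ =>
          Rc (suspMeasure μ (SFT A) f) ((I n) ×ˢ ({0} : Set ℝ)) (SFT A) f /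
            (μ (I n)).toReal) Filter.atTop ≤
        γz / (∫ x, fLower A f m δ x ∂μ) := by
  obtain ⟨hIcyl, -, hInter, ⟨c, hc, ρ, hρ0, hρ1, hdecay⟩, -, -⟩ := hnested
  have hzI : ∀ n, 1 ≤ n → z ∈ I n := by
    have h : z ∈ ⋂ n ∈ Set.Ici 1, I n := hInter ▸ mem_singleton z
    exact fun n hn => mem_iInter₂.1 h n hn
  have hImeas : ∀ n, 1 ≤ n → MeasurableSet (I n) := by
    intro n hn
    obtain ⟨S, -, hS⟩ := hIcyl n hn
    rw [hS]
    exact S.measurableSet_biUnion fun x _ => (measurableSet_SFT A).inter (measurableSet_cyl x n)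
  have hIsub : ∀ n, 1 ≤ n → I n ⊆ SFT A := by
    intro n hn
    obtain ⟨S, -, hS⟩ := hIcyl n hn
    rw [hS]
    exact iUnion₂_subset fun x _ => inter_subset_left
  have hIcont : ∀ n, 1 ≤ n → SFT A ∩ cyl z n ⊆ I n := by
    intro n hn
    obtain ⟨S, -, hS⟩ := hIcyl n hn
    have hzn := hzI n hn
    rw [hS] at hzn ⊢
    obtain ⟨x, hx, hzx⟩ := mem_iUnion₂.1 hzn
    rw [cyl_congr (y := x) hzx.2]
    exact subset_iUnion₂_of_subset x hx subset_rfl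
  have hγ : 0 < γz := by
    by_cases hper : ∃ p : ℕ, 0 < p ∧ (shiftMap a)^[p] z = z
    · classical
      have hsp := Nat.find_spec hper
      rw [hγ2 (Nat.find hper) hsp.1 hsp.2 fun q hq hqz => Nat.find_min' hper ⟨hq, hqz⟩,
        sub_pos, Real.exp_lt_one_iff]
      exact birkhoff_lt_of_periodic hc₁ (fun n hn => (hGibbs z hz n hn).1) hIcont hc hρ0 hρ1
        hdecay hsp.1 hsp.2
    · rw [hγ1 fun p hp hpz => hper ⟨p, hp, hpz⟩]
      exact one_pos
  have hbdd : ∀ x ∈ SFT A, f x ≤ cylSup A f m x := by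
    intro x hx
    obtain ⟨L, hL⟩ := hfLip
    refine le_csSup ⟨f x + L, ?_⟩ ⟨x, ⟨hx, fun i _ => rfl⟩, rfl⟩
    rintro _ ⟨y, ⟨hy, -⟩, rfl⟩
    have := hL y hy x hx 0 (by simp)
    rw [pow_zero, mul_one] at this
    linarith [le_abs_self (f y - f x)]
  have hfu : ∀ x ∈ SFT A, f x + δ ≤ fUpper A f m δ x := by
    intro x hx
    have h1 := (div_lt_iff₀ hδ).1 (Int.lt_floor_add_one (cylSup A f m x / δ))
    rw [fUpper]
    linarith [hbdd x hx]
  have hintu : ∀ x, ∃ N : ℤ, fUpper A f m δ x = N * δ := fun x =>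
    ⟨⌊cylSup A f m x / δ⌋ + 2, by rw [fUpper]; push_cast; rfl⟩
  have hintl : ∀ x, ∃ N : ℤ, fLower A f m δ x = N * δ := fun x =>
    ⟨⌊cylInf A f m x / δ⌋ - 2, by rw [fLower]; push_cast; rfl⟩
  have hcu : ∀ x y, (∀ i < m, x i = y i) → fUpper A f m δ x = fUpper A f m δ y := by
    intro x y h
    rw [fUpper, fUpper, cylSup, cylSup, cyl_congr h]
  have hcl : ∀ x y, (∀ i < m, x i = y i) → fLower A f m δ x = fLower A f m δ y := by
    intro x y h
    rw [fLower, fLower, cylInf, cylInf, cyl_congr h]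
  have hIu : 0 < ∫ x, fUpper A f m δ x ∂μ := one_pos.trans_le <|
    one_le_integral_of_cyl μ hsupp hcu fun x hx => (hf1 x hx).le.trans (hsandwich x hx).2
  have hIf : 0 < ∫ x, f x ∂μ := by linarith
  have hIl : 0 < ∫ x, fLower A f m δ x ∂μ := by linarith
  have hu0 : ∀ x ∈ SFT A, 0 < fUpper A f m δ x := fun x hx => by
    linarith [hf1 x hx, (hsandwich x hx).2]
  have hpos : ∀ {r b : ℝ}, 0 ≤ b → 0 < r / b → 0 < r := fun hb h => by
    by_contra! hr
    exact h.not_ge (div_nonpos_of_nonpos_of_nonneg hr hb)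
  have hscale : ∀ {r G M : ℝ}, 0 < G → r / (δ / G * M) / G = r / δ / M := fun hG => by
    field_simp
  have hev : ∀ᶠ n in atTop,
      RD (discMeasure μ (SFT A) (fUpper A f m δ) δ) ((I n) ×ˢ ({0} : Set ℤ))
          (SFT A) (fUpper A f m δ) δ /
          ((discMeasure μ (SFT A) (fUpper A f m δ) δ) ((I n) ×ˢ ({0} : Set ℤ))).toReal /
          (∫ x, fUpper A f m δ x ∂μ) ≤
        Rc (suspMeasure μ (SFT A) f) ((I n) ×ˢ ({0} : Set ℝ)) (SFT A) f / (μ (I n)).toReal ∧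
      Rc (suspMeasure μ (SFT A) f) ((I n) ×ˢ ({0} : Set ℝ)) (SFT A) f / (μ (I n)).toReal ≤
        RD (discMeasure μ (SFT A) (fLower A f m δ) δ) ((I n) ×ˢ ({0} : Set ℤ))
          (SFT A) (fLower A f m δ) δ /
          ((discMeasure μ (SFT A) (fLower A f m δ) δ) ((I n) ×ˢ ({0} : Set ℤ))).toReal /
          (∫ x, fLower A f m δ x ∂μ) := by
    filter_upwards [hdiscU.eventually_const_lt hγ, hdiscL.eventually_const_lt hγ,
      eventually_ge_atTop 1] with n h1 h2 hn
    have key := Rc_pinching μ hδ hgl0 (fun x hx => (hsandwich x hx).1) hfu hintl hintu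
      (measurable_of_forall_cyl_eq hcl).1 (measurable_of_forall_cyl_eq hcu).1 hIl hIf hIu
      (hImeas n hn) (hpos ENNReal.toReal_nonneg h2) (hpos ENNReal.toReal_nonneg h1)
    rw [discMeasure_base_toReal μ hδ hu0 hIu (hIsub n hn),
      discMeasure_base_toReal μ hδ hgl0 hIl (hIsub n hn), hscale hIu, hscale hIl]
    exact ⟨div_le_div_of_nonneg_right key.1 ENNReal.toReal_nonneg,
      div_le_div_of_nonneg_right key.2 ENNReal.toReal_nonneg⟩
  have hU := hdiscU.div_const (∫ x, fUpper A f m δ x ∂μ)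
  have hL := hdiscL.div_const (∫ x, fLower A f m δ x ∂μ)
  have hle := hev.mono fun n h => h.1
  have hge := hev.mono fun n h => h.2
  constructor
  · rw [← hU.liminf_eq]
    exact liminf_le_liminf hle hU.isBoundedUnder_ge
      (hL.isBoundedUnder_le.mono_le hge).isCoboundedUnder_ge
  · rw [← hL.limsup_eq]
    exact limsup_le_limsup hge (hU.isBoundedUnder_ge.mono_ge hle).isCoboundedUnder_le
      hL.isBoundedUnder_le

end
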